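/- arXiv:1310.7168 — 10 statements merged into one kernel-verified Lean document; each statement's English description precedes it below -/
import Mathlib

section
/- Consider one step of the additive Runge–Kutta method applied to functions F_1,…,F_r : ℝ × ℝ^m → ℝ^m with F = F_1 + ⋯ + F_r, producing stage vectors v_{n,1},…,v_{n,s} and the update u_{n+1} from u_n. If a vector h ∈ ℝ^m satisfies h^T F(t,w) = 0 for all t ∈ ℝ and all w ∈ ℝ^m, then for every index l ∈ {1,…,r} one has h^T u_{n+1} = h^T u_n + Δt · Σ_{k≠l} Σ_{j=1}^{s} (b_j^{(k)} − b_j^{(l)}) · h^T F_k(t_n + c_j Δt, v_{n,j}). -/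
/-- One step of an additive (partitioned) Runge–Kutta method: if `hᵀ F(t,w) = 0`
for `F = F₁ + ⋯ + F_r`, then for each `l` we have
`hᵀ u_{n+1} = hᵀ u_n + Δt ∑_{k≠l} ∑_j (b_j^{(k)} − b_j^{(l)}) hᵀ F_k(t_n + c_j Δt, v_{n,j})`. -/
theorem stmt_0
    (s r m : ℕ)
    (A : Fin r → Matrix (Fin s) (Fin s) ℝ)
    (b : Fin r → Fin s → ℝ)
    (c : Fin s → ℝ)
    (F : Fin r → ℝ → (Fin m → ℝ) → (Fin m → ℝ))
    (h : Fin m → ℝ)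
    (hF : ∀ (t : ℝ) (w : Fin m → ℝ), ∑ i, h i * (∑ k, F k t w) i = 0)
    (Δt : ℝ) (hΔt : 0 < Δt)
    (tn : ℝ) (un : Fin m → ℝ)
    (v : Fin s → (Fin m → ℝ))
    (hv : ∀ i, v i = un + Δt • ∑ k, ∑ j, A k i j • F k (tn + c j * Δt) (v j))
    (unext : Fin m → ℝ)
    (hu : unext = un + Δt • ∑ k, ∑ j, b k j • F k (tn + c j * Δt) (v j))
    (l : Fin r) :
    ∑ i, h i * unext i =
      ∑ i, h i * un i +
        Δt * ∑ k ∈ Finset.univ.erase l, ∑ j,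
          (b k j - b l j) * ∑ i, h i * F k (tn + c j * Δt) (v j) i := by
  change h ⬝ᵥ unext = h ⬝ᵥ un + Δt * ∑ k ∈ Finset.univ.erase l, ∑ j,
    (b k j - b l j) * (h ⬝ᵥ F k (tn + c j * Δt) (v j))
  have hsum : ∀ j, ∑ k, h ⬝ᵥ F k (tn + c j * Δt) (v j) = 0 := fun j => by
    rw [← dotProduct_sum]
    exact hF _ _
  have hl : ∑ k, ∑ j, b l j * (h ⬝ᵥ F k (tn + c j * Δt) (v j)) = 0 := by
    rw [Finset.sum_comm]
    simp [← Finset.mul_sum, hsum]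
  rw [Finset.sum_erase _ (by simp), hu]
  simp only [dotProduct_add, dotProduct_smul, dotProduct_sum, smul_eq_mul, sub_mul,
    Finset.sum_sub_distrib, hl, sub_zero]
end

section
/- Consider one step of the additive Runge–Kutta method applied to functions F_1,…,F_r : ℝ × ℝ^m → ℝ^m with F = F_1 + ⋯ + F_r, producing the update u_{n+1} from u_n. If a vector h ∈ ℝ^m satisfies h^T F(t,w) = 0 for all t ∈ ℝ and all w ∈ ℝ^m, and if the weight vectors coincide, b_j^{(k)} = b_j^{(l)} for all 1 ≤ k, l ≤ r and 1 ≤ j ≤ s, then the linear invariant is conserved exactly: h^T u_{n+1} = h^T u_n. -/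
/-- One step of an additive (partitioned) Runge–Kutta method: if `hᵀ F(t,w) = 0` for
`F = F₁ + ⋯ + F_r` and all weight vectors coincide, then `hᵀ u_{n+1} = hᵀ u_n`. -/
theorem stmt_1
    (s r m : ℕ)
    (A : Fin r → Matrix (Fin s) (Fin s) ℝ)
    (b : Fin r → Fin s → ℝ)
    (c : Fin s → ℝ)
    (F : Fin r → ℝ → (Fin m → ℝ) → (Fin m → ℝ))
    (h : Fin m → ℝ)
    (hF : ∀ (t : ℝ) (w : Fin m → ℝ), ∑ i, h i * (∑ k, F k t w) i = 0)
    (hb : ∀ (k l : Fin r) (j : Fin s), b k j = b l j)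
    (Δt : ℝ) (hΔt : 0 < Δt)
    (tn : ℝ) (un : Fin m → ℝ)
    (v : Fin s → (Fin m → ℝ))
    (hv : ∀ i, v i = un + Δt • ∑ k, ∑ j, A k i j • F k (tn + c j * Δt) (v j))
    (unext : Fin m → ℝ)
    (hu : unext = un + Δt • ∑ k, ∑ j, b k j • F k (tn + c j * Δt) (v j)) :
    ∑ i, h i * unext i = ∑ i, h i * un i := by
  obtain ⟨β, hβ⟩ : ∃ β : Fin s → ℝ, ∀ k j, b k j = β j := by
    rcases isEmpty_or_nonempty (Fin r) with hr | ⟨⟨k₀⟩⟩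
    · exact ⟨0, fun k => hr.elim k⟩
    · exact ⟨b k₀, fun k j => hb k k₀ j⟩
  have hsum : ∑ k, ∑ j, b k j • F k (tn + c j * Δt) (v j)
      = ∑ j, β j • ∑ k, F k (tn + c j * Δt) (v j) := by
    rw [Finset.sum_comm]
    simp only [hβ, Finset.smul_sum]
  have hdot : ∀ (t : ℝ) (w : Fin m → ℝ), h ⬝ᵥ (∑ k, F k t w) = 0 := hF
  change h ⬝ᵥ unext = h ⬝ᵥ un
  rw [hu, hsum, dotProduct_add, dotProduct_smul, dotProduct_sum]
  simp only [dotProduct_smul, hdot, smul_zero, Finset.sum_const_zero, add_zero]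
end

section
/- Let A ∈ ℝ^{s×s} be strictly lower triangular and let c ∈ ℝ^s satisfy A e = c and A c = (1/2) c², where c² denotes the componentwise square and e = (1,…,1)^T. Then c = 0. Consequently A e = 0, so no vector b ∈ ℝ^s can satisfy the second-order condition b^T A e = 1/2; in particular an explicit additive Runge–Kutta method cannot simultaneously have stage order q ≥ 2 and classical order p ≥ 2. -/
/-- If `A` is strictly lower triangular, `A e = c` and `A c = c²/2`, then `c = 0`;
consequently `A e = 0` and no weight vector `b` can satisfy `bᵀ A e = 1/2`, so an explicit
method cannot have stage order `q ≥ 2` together with classical order `p ≥ 2`. -/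
theorem stmt_2
    (s : ℕ) (A : Matrix (Fin s) (Fin s) ℝ)
    (hA : ∀ i j : Fin s, i ≤ j → A i j = 0)
    (c : Fin s → ℝ)
    (hAe : ∀ i, ∑ j, A i j = c i)
    (hAc : ∀ i, ∑ j, A i j * c j = c i ^ 2 / 2) :
    c = 0 ∧ (∀ i, ∑ j, A i j = 0) ∧
      ∀ b : Fin s → ℝ, ∑ i, b i * ∑ j, A i j ≠ 1 / 2 := by
  have hc : ∀ i, c i = 0 := by
    intro i
    induction i using WellFoundedLT.induction with
    | ind i ih =>
      have hsum : ∑ j, A i j * c j = 0 := by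
        refine Finset.sum_eq_zero fun j _ => ?_
        rcases lt_or_ge j i with hji | hij
        · rw [ih j hji, mul_zero]
        · rw [hA i j hij, zero_mul]
      have hsq : c i ^ 2 = 0 := by linarith [hAc i]
      exact pow_eq_zero_iff two_ne_zero |>.mp hsq
  have hrow : ∀ i, ∑ j, A i j = 0 := fun i => (hAe i).trans (hc i)
  exact ⟨funext hc, hrow, fun b => by simp [hrow]⟩
end

section
/- Let L = L_1 + ⋯ + L_r with L_k ∈ ℝ^{m×m}, let g = g_1 + ⋯ + g_r with each g_k : ℝ → ℝ^m, and let u : ℝ → ℝ^m solve u'(t) = L u(t) + g(t). Consider an s-stage explicit additive Runge–Kutta method with coefficients A_k, b_k, abscissae c = A_r e with 0 ≤ c_i for all i, applied with step size Δt > 0 and F_k(t,w) = L_k w + g_k(t). Set Z_k = Δt L_k, φ_k(t) = L_k u(t) + g_k(t), and let δ_n = u(t_{n+1}) − û, where û is the result of one step of the method started from the exact value u(t_n). Assume each φ_k is l times continuously differentiable and that the blocks of r(Z)^T = [r_1(Z),…,r_s(Z)] satisfy ‖r_i(Z)‖_∞ ≤ M for i = 1,…,s. Then there is a constant C > 0,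 depending only on s, r, l, M and the method coefficients, such that ‖δ_n − Σ_{j=1}^{l} (Δt^j / j!) Σ_{k=1}^{r} d_{j,k}(Z) φ_k^{(j-1)}(t_n)‖_∞ ≤ C Δt^{l+1} · max_{1≤k≤r} sup_{t ∈ J} ‖φ_k^{(l)}(t)‖_∞, where J = [t_n, t_n + ĉ Δt] with ĉ = max{1, c_1,…,c_s}. -/
open Matrix Kronecker Finset

attribute [local instance] Matrix.linftyOpNormedAddCommGroup

/-- Taylor expansion with remainder bound for a vector-valued function of a real variable. -/
theorem norm_sub_taylor_sum_le {E : Type*} [NormedAddCommGroup E] [NormedSpace ℝ E]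
    {n : ℕ} {f : ℝ → E} (hf : ContDiff ℝ n f) {a x K : ℝ} (hax : a ≤ x)
    (hK : ∀ t ∈ Set.Icc a x, ‖iteratedDeriv n f t‖ ≤ K) :
    ‖f x - ∑ q ∈ range n, ((x - a) ^ q / (q.factorial : ℝ)) • iteratedDeriv q f a‖ ≤
      K * (x - a) ^ n := by
  induction n generalizing f x with
  | zero => simpa using hK x ⟨hax, le_rfl⟩
  | succ n ih =>
    have hf' : ContDiff ℝ n (deriv f) := hf.deriv'
    have hd : Differentiable ℝ f := hf.differentiable (by simp)
    have hK0 : 0 ≤ K := (norm_nonneg _).trans (hK a ⟨le_rfl, hax⟩)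
    let F : ℝ → E := fun y => f y - ∑ q ∈ range (n + 1),
      ((y - a) ^ q / (q.factorial : ℝ)) • iteratedDeriv q f a
    have hF : ∀ y, HasDerivAt F (deriv f y - ∑ q ∈ range n,
        ((y - a) ^ q / (q.factorial : ℝ)) • iteratedDeriv q (deriv f) a) y := by
      intro y
      refine (hd y).hasDerivAt.sub ?_
      have h : ∀ q ∈ range (n + 1), HasDerivAt
          (fun y => ((y - a) ^ q / (q.factorial : ℝ)) • iteratedDeriv q f a)
          (((q : ℝ) * (y - a) ^ (q - 1) / (q.factorial : ℝ)) • iteratedDeriv q f a) y := by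
        intro q _
        have := ((((hasDerivAt_id y).sub_const a).pow q).div_const (q.factorial : ℝ)).smul_const
          (iteratedDeriv q f a)
        simpa using this
      convert HasDerivAt.fun_sum h using 1
      rw [Finset.sum_range_succ']
      simp only [Nat.cast_zero, zero_mul, zero_div, zero_smul, add_zero]
      refine Finset.sum_congr rfl fun q _ => ?_
      rw [iteratedDeriv_succ', Nat.factorial_succ]
      congr 1
      push_cast
      have : (q.factorial : ℝ) ≠ 0 := by positivity
      field_simp
    have hFa : F a = 0 := by
      simp [F, Finset.sum_range_succ']
    have := norm_image_sub_le_of_norm_deriv_le_segment' (f := F) (a := a) (b := x)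
      (C := K * (x - a) ^ n) (fun y _ => (hF y).hasDerivWithinAt) (fun y hy => by
        refine (ih hf' hy.1 fun t ht => ?_).trans ?_
        · rw [← iteratedDeriv_succ']
          exact hK t ⟨ht.1, ht.2.trans hy.2.le⟩
        · have := hy.1
          have := hy.2.le
          gcongr) x ⟨hax, le_rfl⟩
    rw [hFa, sub_zero] at this
    simpa [F, pow_succ, mul_assoc] using this

/-- The stage matrix of an explicit additive Runge–Kutta method is invertible. -/
theorem isUnit_one_sub_sum_kronecker {r s m : ℕ} (A : Fin r → Matrix (Fin s) (Fin s) ℝ)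
    (hA : ∀ k, ∀ i j : Fin s, i ≤ j → A k i j = 0) (Z : Fin r → Matrix (Fin m) (Fin m) ℝ) :
    IsUnit (1 - ∑ k, (A k) ⊗ₖ (Z k)).det := by
  have hN : ∀ p q : Fin s × Fin m, p.1 ≤ q.1 → (∑ k, (A k) ⊗ₖ (Z k)) p q = 0 := by
    intro p q hpq
    simp [Matrix.sum_apply, hA _ _ _ hpq]
  have ht : Matrix.BlockTriangular (1 - ∑ k, (A k) ⊗ₖ (Z k))
      (fun p : Fin s × Fin m => OrderDual.toDual p.1) := by
    intro p q hpq
    have hlt : p.1 < q.1 := hpq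
    have : p ≠ q := fun h => by simp [h] at hlt
    simp only [Matrix.sub_apply]
    rw [hN p q hlt.le, Matrix.one_apply_ne this, sub_zero]
  rw [ht.det_fintype]
  have hb : ∀ i, Matrix.toSquareBlock (1 - ∑ k, (A k) ⊗ₖ (Z k))
      (fun p : Fin s × Fin m => OrderDual.toDual p.1) i = 1 := by
    intro i
    ext ⟨p, hp⟩ ⟨q, hq⟩
    have : p.1 ≤ q.1 := le_of_eq (OrderDual.toDual.injective (hp.trans hq.symm))
    simp [Matrix.toSquareBlock_def, Matrix.sub_apply, hN p q this, Matrix.one_apply]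
  simp [hb]

/-- A block row with blocks bounded by `M` maps a block vector to one of norm at most
`M` times the sum of the norms of its blocks. -/
theorem norm_mulVec_le_sum_blocks {s m : ℕ} (R : Matrix (Fin m) (Fin s × Fin m) ℝ)
    (x : Fin s → Fin m → ℝ) {M : ℝ}
    (hR : ∀ i : Fin s,
      ‖(Matrix.of fun a a' => R a (i, a') : Matrix (Fin m) (Fin m) ℝ)‖ ≤ M) :
    ‖R.mulVec (fun p => x p.1 p.2)‖ ≤ ∑ i, M * ‖x i‖ := by
  have : R.mulVec (fun p => x p.1 p.2) =
      ∑ i, (Matrix.of fun a a' => R a (i, a') : Matrix (Fin m) (Fin m) ℝ).mulVec (x i) := by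
    ext a
    simp [Matrix.mulVec, dotProduct, Fintype.sum_prod_type]
  rw [this]
  refine (norm_sum_le _ _).trans (Finset.sum_le_sum fun i _ => ?_)
  exact (Matrix.linfty_opNorm_mulVec _ _).trans (by gcongr; exact hR i)

theorem sum_Icc_one_eq_sum_range {E : Type*} [AddCommMonoid E] (f : ℕ → E) (l : ℕ) :
    ∑ j ∈ Icc 1 l, f j = ∑ q ∈ range l, f (q + 1) := by
  induction l with
  | zero => simp
  | succ n ih => rw [Finset.sum_Icc_succ_top (by omega), ih, Finset.sum_range_succ]

/-- Expansion of the residual of the quadrature rules with weights `w k` and nodes `c`, applied to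
`φ k` on `[a, a + x * h]`, where `∑ k, φ k` is the derivative of `u`. -/
theorem norm_quadrature_residual_sub_le {E : Type*} [NormedAddCommGroup E] [NormedSpace ℝ E]
    {r s l : ℕ} {u : ℝ → E} {φ : Fin r → ℝ → E} (hu : ∀ t, HasDerivAt u (∑ k, φ k t) t)
    (hφ : ∀ k, ContDiff ℝ l (φ k)) (w : Fin r → Fin s → ℝ) {c : Fin s → ℝ} (hc : ∀ i, 0 ≤ c i)
    {a h x b Φ : ℝ} (hh : 0 ≤ h) (hx : 0 ≤ x) (hxb : a + x * h ≤ b)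
    (hcb : ∀ i, a + c i * h ≤ b)
    (hΦ : ∀ k, ∀ t ∈ Set.Icc a b, ‖iteratedDeriv l (φ k) t‖ ≤ Φ) :
    ‖(u (a + x * h) - u a - h • ∑ k, ∑ j, w k j • φ k (a + c j * h)) -
        ∑ j ∈ Icc 1 l, (h ^ j / (j.factorial : ℝ)) •
          ∑ k, (x ^ j - j * ∑ i, w k i * c i ^ (j - 1)) • iteratedDeriv (j - 1) (φ k) a‖ ≤
      (r * x ^ (l + 1) + ∑ k, ∑ j, |w k j| * c j ^ l) * h ^ (l + 1) * Φ := by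
  have hderiv : deriv u = fun t => ∑ k, φ k t := funext fun t => (hu t).deriv
  have hu' : ContDiff ℝ ((l + 1 : ℕ) : WithTop ℕ∞) u := by
    rw [Nat.cast_add, Nat.cast_one, contDiff_succ_iff_deriv]
    refine ⟨fun t => (hu t).differentiableAt, by simp, ?_⟩
    rw [hderiv]
    exact ContDiff.sum fun k _ => hφ k
  have hiter : ∀ q ≤ l, ∀ t, iteratedDeriv (q + 1) u t = ∑ k, iteratedDeriv q (φ k) t := by
    intro q hq t
    rw [iteratedDeriv_succ', hderiv]
    exact iteratedDeriv_fun_sum fun k _ => ((hφ k).of_le (by exact_mod_cast hq)).contDiffAt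
  have hxh : 0 ≤ x * h := by positivity
  have hU := norm_sub_taylor_sum_le (n := l + 1) hu' (a := a) (x := a + x * h) (K := r * Φ)
    (by linarith) (fun t ht => by
      rw [hiter l le_rfl]
      refine (norm_sum_le _ _).trans ?_
      refine (Finset.sum_le_sum fun k _ => hΦ k t ⟨ht.1, ht.2.trans hxb⟩).trans ?_
      simp)
  have hP : ∀ k j, ‖φ k (a + c j * h) - ∑ q ∈ range l,
      ((c j * h) ^ q / (q.factorial : ℝ)) • iteratedDeriv q (φ k) a‖ ≤ Φ * (c j * h) ^ l := by
    intro k j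
    have : 0 ≤ c j * h := mul_nonneg (hc j) hh
    simpa using norm_sub_taylor_sum_le (n := l) (hφ k) (a := a) (x := a + c j * h) (K := Φ)
      (by linarith) (fun t ht => hΦ k t ⟨ht.1, ht.2.trans (hcb j)⟩)
  have hcoef : ∀ q k, (h ^ (q + 1) / ((q + 1).factorial : ℝ)) •
      (x ^ (q + 1) - ((q + 1 : ℕ) : ℝ) * ∑ i, w k i * c i ^ q) • iteratedDeriv q (φ k) a =
      ((x * h) ^ (q + 1) / ((q + 1).factorial : ℝ)) • iteratedDeriv q (φ k) a -
      h • ∑ j, w k j • ((c j * h) ^ q / (q.factorial : ℝ)) • iteratedDeriv q (φ k) a := by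
    intro q k
    simp only [smul_smul, ← Finset.sum_smul, ← sub_smul]
    congr 1
    have h1 : ∑ j, w k j * ((c j * h) ^ q / (q.factorial : ℝ)) =
        (∑ j, w k j * c j ^ q) * (h ^ q / (q.factorial : ℝ)) := by
      rw [Finset.sum_mul]
      refine Finset.sum_congr rfl fun j _ => ?_
      rw [mul_pow]
      ring
    rw [h1, Nat.factorial_succ]
    have : (q.factorial : ℝ) ≠ 0 := by positivity
    push_cast
    field_simp
    ring
  have hsplit : (u (a + x * h) - u a - h • ∑ k, ∑ j, w k j • φ k (a + c j * h)) -
        ∑ j ∈ Icc 1 l, (h ^ j / (j.factorial : ℝ)) •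
          ∑ k, (x ^ j - j * ∑ i, w k i * c i ^ (j - 1)) • iteratedDeriv (j - 1) (φ k) a =
      (u (a + x * h) - ∑ q ∈ range (l + 1),
        ((x * h) ^ q / (q.factorial : ℝ)) • iteratedDeriv q u a) -
      h • ∑ k, ∑ j, w k j • (φ k (a + c j * h) - ∑ q ∈ range l,
        ((c j * h) ^ q / (q.factorial : ℝ)) • iteratedDeriv q (φ k) a) := by
    have h2 : ∑ q ∈ range (l + 1), ((x * h) ^ q / (q.factorial : ℝ)) • iteratedDeriv q u a =
        (∑ q ∈ range l, ∑ k, ((x * h) ^ (q + 1) / ((q + 1).factorial : ℝ)) •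
          iteratedDeriv q (φ k) a) + u a := by
      rw [Finset.sum_range_succ']
      congr 1
      · refine Finset.sum_congr rfl fun q hq => ?_
        rw [hiter q (Finset.mem_range.1 hq).le, Finset.smul_sum]
      · simp
    have h3 : ∑ k, ∑ j, w k j • (∑ q ∈ range l,
        ((c j * h) ^ q / (q.factorial : ℝ)) • iteratedDeriv q (φ k) a) =
        ∑ q ∈ range l, ∑ k, ∑ j, w k j • ((c j * h) ^ q / (q.factorial : ℝ)) •
          iteratedDeriv q (φ k) a := by
      simp only [Finset.smul_sum]
      rw [Finset.sum_comm (s := range l)]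
      exact Finset.sum_congr rfl fun k _ => Finset.sum_comm
    have h4 : ∑ q ∈ range l, (h ^ (q + 1) / ((q + 1).factorial : ℝ)) •
        ∑ k, (x ^ (q + 1) - ((q + 1 : ℕ) : ℝ) * ∑ i, w k i * c i ^ q) •
          iteratedDeriv q (φ k) a =
        (∑ q ∈ range l, ∑ k, ((x * h) ^ (q + 1) / ((q + 1).factorial : ℝ)) •
          iteratedDeriv q (φ k) a) -
        h • ∑ q ∈ range l, ∑ k, ∑ j, w k j • ((c j * h) ^ q / (q.factorial : ℝ)) •
          iteratedDeriv q (φ k) a := by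
      rw [Finset.smul_sum, ← Finset.sum_sub_distrib]
      refine Finset.sum_congr rfl fun q _ => ?_
      rw [Finset.smul_sum, Finset.smul_sum, ← Finset.sum_sub_distrib]
      exact Finset.sum_congr rfl fun k _ => hcoef q k
    rw [sum_Icc_one_eq_sum_range, h2]
    simp only [smul_sub, Finset.sum_sub_distrib, h3, Nat.add_sub_cancel, h4]
    abel
  rw [hsplit]
  have hsum : ‖∑ k, ∑ j, w k j • (φ k (a + c j * h) - ∑ q ∈ range l,
        ((c j * h) ^ q / (q.factorial : ℝ)) • iteratedDeriv q (φ k) a)‖ ≤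
      ∑ k, ∑ j, |w k j| * (Φ * (c j * h) ^ l) := by
    refine norm_sum_le_of_le _ fun k _ => norm_sum_le_of_le _ fun j _ => ?_
    rw [norm_smul, Real.norm_eq_abs]
    gcongr
    exact hP k j
  calc _ ≤ r * Φ * (x * h) ^ (l + 1) + h * ∑ k, ∑ j, |w k j| * (Φ * (c j * h) ^ l) := by
        refine (norm_sub_le _ _).trans (add_le_add (by simpa using hU) ?_)
        rw [norm_smul, Real.norm_of_nonneg hh]
        gcongr
    _ = _ := by
        have : ∑ k, ∑ j, |w k j| * (Φ * (c j * h) ^ l) =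
            (∑ k, ∑ j, |w k j| * c j ^ l) * (Φ * h ^ l) := by
          simp only [Finset.sum_mul]
          refine Finset.sum_congr rfl fun k _ => Finset.sum_congr rfl fun j _ => ?_
          rw [mul_pow]
          ring
        rw [this]
        ring

/-- Local error expansion for an explicit additive Runge–Kutta method applied to a linear
semi-discrete system `u' = Lu + g`, `L = L₁ + ⋯ + L_r`, `g = g₁ + ⋯ + g_r`:
with `φₖ(t) = Lₖ u(t) + gₖ(t)` of class `C^l` and bounded blocks `rᵢ(Z)`, the local error
`δₙ = u(t_{n+1}) − û` satisfies
`δₙ = ∑_{j=1}^{l} (Δtʲ/j!) ∑ₖ d_{j,k}(Z) φₖ^{(j−1)}(tₙ) + O(Δt^{l+1}) · max_{k,t∈J} ‖φₖ^{(l)}(t)‖`,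
with a constant depending only on `s, r, l, M` and the method coefficients. -/
theorem stmt_5
    (s r l : ℕ) (hr : 0 < r)
    (A : Fin r → Matrix (Fin s) (Fin s) ℝ)
    (hA : ∀ k, ∀ i j : Fin s, i ≤ j → A k i j = 0)
    (b : Fin r → Fin s → ℝ)
    (c : Fin s → ℝ)
    (hc : ∀ i, c i = ∑ j, A ⟨r - 1, by omega⟩ i j)
    (hcnn : ∀ i, 0 ≤ c i)
    (M : ℝ) :
    ∃ C > 0,
      ∀ (m : ℕ)
        (Lk : Fin r → Matrix (Fin m) (Fin m) ℝ)
        (g : Fin r → ℝ → (Fin m → ℝ))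
        (u : ℝ → (Fin m → ℝ))
        (φ : Fin r → ℝ → (Fin m → ℝ)),
        (∀ k t, φ k t = (Lk k).mulVec (u t) + g k t) →
        (∀ t, HasDerivAt u ((∑ k, Lk k).mulVec (u t) + ∑ k, g k t) t) →
        (∀ k, ContDiff ℝ (l : ℕ∞) (φ k)) →
        ∀ (Δt : ℝ), 0 < Δt →
        ∀ (rT : Matrix (Fin m) (Fin s × Fin m) ℝ),
          rT = (Matrix.of fun i p => ∑ k, b k p.1 * (Δt • Lk k) i p.2) *
               (1 - ∑ k, (A k) ⊗ₖ (Δt • Lk k))⁻¹ →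
          (∀ i : Fin s,
            ‖(Matrix.of fun a a' => rT a (i, a') : Matrix (Fin m) (Fin m) ℝ)‖ ≤ M) →
        ∀ (d : ℕ → Fin r → Matrix (Fin m) (Fin m) ℝ),
          (∀ (j : ℕ) (k : Fin r),
            d j k =
              (1 - (j : ℝ) * ∑ i, b k i * c i ^ (j - 1)) • (1 : Matrix (Fin m) (Fin m) ℝ)
              + rT * Matrix.of (fun p i =>
                  (c p.1 ^ j - (j : ℝ) * ∑ j', A k p.1 j' * c j' ^ (j - 1)) *
                    (if p.2 = i then (1 : ℝ) else 0))) →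
        ∀ (tn : ℝ) (v : Fin s → (Fin m → ℝ)),
          (∀ i, v i = u tn +
              Δt • ∑ k, ∑ j, A k i j • ((Lk k).mulVec (v j) + g k (tn + c j * Δt))) →
        ∀ (Φ : ℝ),
          (∀ k, ∀ t ∈ Set.Icc tn (tn + max 1 (⨆ i, c i) * Δt),
            ‖iteratedDeriv l (φ k) t‖ ≤ Φ) →
          ‖(u (tn + Δt) -
              (u tn + Δt • ∑ k, ∑ j, b k j • ((Lk k).mulVec (v j) + g k (tn + c j * Δt)))) -
            ∑ j ∈ Finset.Icc 1 l,
              (Δt ^ j / (Nat.factorial j : ℝ)) •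
                ∑ k, (d j k).mulVec (iteratedDeriv (j - 1) (φ k) tn)‖
            ≤ C * Δt ^ (l + 1) * Φ := by
  let K : ℝ → (Fin r → Fin s → ℝ) → ℝ := fun x w =>
    r * x ^ (l + 1) + ∑ k, ∑ j, |w k j| * c j ^ l
  have hK : ∀ x w, 0 ≤ x → 0 ≤ K x w := fun x w hx => by
    have : ∀ k j, 0 ≤ |w k j| * c j ^ l := fun k j =>
      mul_nonneg (abs_nonneg _) (pow_nonneg (hcnn j) _)
    have : 0 ≤ ∑ k, ∑ j, |w k j| * c j ^ l :=
      Finset.sum_nonneg fun k _ => Finset.sum_nonneg fun j _ => this k j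
    positivity
  have hS : 0 ≤ ∑ i, |M| * K (c i) (fun k => A k i) :=
    Finset.sum_nonneg fun i _ => mul_nonneg (abs_nonneg _) (hK _ _ (hcnn i))
  refine ⟨K 1 b + ∑ i, |M| * K (c i) (fun k => A k i) + 1,
    by linarith [hK 1 b zero_le_one], ?_⟩
  intro m Lk g u φ hφ hu hsm Δt hΔ rT hrT hM d hd tn v hv Φ hΦ
  have hu' : ∀ t, HasDerivAt u (∑ k, φ k t) t := by
    intro t
    convert hu t using 1
    simp [hφ, Finset.sum_add_distrib, Matrix.sum_mulVec]
  have hΦ0 : 0 ≤ Φ := (norm_nonneg _).trans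
    (hΦ ⟨0, hr⟩ tn ⟨le_rfl, by
      have : 0 ≤ max 1 (⨆ i, c i) := zero_le_one.trans (le_max_left _ _)
      nlinarith [mul_nonneg this hΔ.le]⟩)
  have hcb : ∀ i, tn + c i * Δt ≤ tn + max 1 (⨆ i, c i) * Δt := by
    intro i
    have : c i ≤ max 1 (⨆ i, c i) :=
      (le_ciSup (Set.finite_range c).bddAbove i).trans (le_max_right _ _)
    gcongr
  have h1b : tn + 1 * Δt ≤ tn + max 1 (⨆ i, c i) * Δt := by
    gcongr
    exact le_max_left _ _
  let γ : ℝ → (Fin r → Fin s → ℝ) → ℕ → Fin r → ℝ := fun x w j k =>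
    x ^ j - j * ∑ i, w k i * c i ^ (j - 1)
  let ρ : ℝ → (Fin r → Fin s → ℝ) → Fin m → ℝ := fun x w =>
    u (tn + x * Δt) - u tn - Δt • ∑ k, ∑ j, w k j • φ k (tn + c j * Δt)
  let P : ℝ → (Fin r → Fin s → ℝ) → Fin m → ℝ := fun x w =>
    ∑ j ∈ Icc 1 l, (Δt ^ j / (j.factorial : ℝ)) •
      ∑ k, γ x w j k • iteratedDeriv (j - 1) (φ k) tn
  have hres : ∀ x w, 0 ≤ x → tn + x * Δt ≤ tn + max 1 (⨆ i, c i) * Δt →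
      ‖ρ x w - P x w‖ ≤ K x w * Δt ^ (l + 1) * Φ := fun x w hx hxb =>
    norm_quadrature_residual_sub_le hu' (fun k => by exact_mod_cast hsm k) w hcnn hΔ.le hx hxb
      hcb hΦ
  let err : Fin s → Fin m → ℝ := fun i => u (tn + c i * Δt) - v i
  have hstage : ∀ (x : ℝ) (w : Fin r → Fin s → ℝ), u (tn + x * Δt) -
      (u tn + Δt • ∑ k, ∑ j, w k j • ((Lk k).mulVec (v j) + g k (tn + c j * Δt))) =
      ρ x w + ∑ k, ∑ j, w k j • (Δt • Lk k).mulVec (err j) := by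
    intro x w
    have : ∑ k, ∑ j, w k j • (Δt • Lk k).mulVec (err j) =
        Δt • (∑ k, ∑ j, w k j • φ k (tn + c j * Δt) -
          ∑ k, ∑ j, w k j • ((Lk k).mulVec (v j) + g k (tn + c j * Δt))) := by
      simp only [← Finset.sum_sub_distrib, Finset.smul_sum]
      refine Finset.sum_congr rfl fun k _ => Finset.sum_congr rfl fun j _ => ?_
      rw [hφ, ← smul_sub, add_sub_add_right_eq_sub, ← Matrix.mulVec_sub, Matrix.smul_mulVec,
        smul_comm]
    rw [this]
    simp only [ρ, smul_sub]
    abel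
  have herr : (1 - ∑ k, (A k) ⊗ₖ (Δt • Lk k)).mulVec (fun p => err p.1 p.2) =
      fun p => ρ (c p.1) (fun k => A k p.1) p.2 := by
    have hi : ∀ i, err i = ρ (c i) (fun k => A k i) +
        ∑ k, ∑ j, A k i j • (Δt • Lk k).mulVec (err j) := by
      intro i
      rw [← hstage (c i) (fun k => A k i), ← hv i]
    ext ⟨i, a⟩
    rw [Matrix.sub_mulVec, Matrix.one_mulVec, Pi.sub_apply, Matrix.sum_mulVec]
    have hk : (∑ k, ((A k) ⊗ₖ (Δt • Lk k)).mulVec (fun p : Fin s × Fin m => err p.1 p.2)) (i, a) =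
        (∑ k, ∑ j, A k i j • (Δt • Lk k).mulVec (err j)) a := by
      simp only [Finset.sum_apply]
      refine Finset.sum_congr rfl fun k _ => ?_
      simp [Matrix.mulVec, dotProduct, Fintype.sum_prod_type, Finset.mul_sum, mul_assoc]
    rw [hk, sub_eq_iff_eq_add, ← Pi.add_apply, ← hi i]
  let B : Matrix (Fin m) (Fin s × Fin m) ℝ := Matrix.of fun i p => ∑ k, b k p.1 * (Δt • Lk k) i p.2
  have hrT' : rT = B * (1 - ∑ k, (A k) ⊗ₖ (Δt • Lk k))⁻¹ := hrT
  have hprop : ∑ k, ∑ j, b k j • (Δt • Lk k).mulVec (err j) =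
      rT.mulVec (fun p => ρ (c p.1) (fun k => A k p.1) p.2) := by
    rw [← herr, hrT', Matrix.mulVec_mulVec, Matrix.mul_assoc,
      Matrix.nonsing_inv_mul _ (isUnit_one_sub_sum_kronecker A hA _), Matrix.mul_one]
    ext a
    simp only [B, Matrix.mulVec, dotProduct, Fintype.sum_prod_type, Finset.sum_apply, Matrix.of_apply,
      Pi.smul_apply, smul_eq_mul, Finset.mul_sum, Finset.sum_mul]
    rw [Finset.sum_comm]
    refine Finset.sum_congr rfl fun j _ => ?_
    rw [Finset.sum_comm]
    simp [Matrix.smul_apply, mul_assoc]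
  have hdsum : ∑ j ∈ Icc 1 l, (Δt ^ j / (j.factorial : ℝ)) •
      ∑ k, (d j k).mulVec (iteratedDeriv (j - 1) (φ k) tn) =
      P 1 b + rT.mulVec (fun p => P (c p.1) (fun k => A k p.1) p.2) := by
    let G : ℕ → Fin r → Matrix (Fin s × Fin m) (Fin m) ℝ := fun j k => Matrix.of fun p i =>
      γ (c p.1) (fun k => A k p.1) j k * (if p.2 = i then (1 : ℝ) else 0)
    have hd' : ∀ j k, d j k =
        (1 - (j : ℝ) * ∑ i, b k i * c i ^ (j - 1)) • (1 : Matrix (Fin m) (Fin m) ℝ) +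
          rT * G j k := hd
    have hdk : ∀ j k (y : Fin m → ℝ), (d j k).mulVec y = γ 1 b j k • y +
        rT.mulVec (fun p => γ (c p.1) (fun k => A k p.1) j k * y p.2) := by
      intro j k y
      rw [hd', Matrix.add_mulVec, Matrix.smul_mulVec, Matrix.one_mulVec, ← Matrix.mulVec_mulVec]
      congr 2
      · simp [γ]
      · ext p
        simp [Matrix.mulVec, dotProduct, G]
    have hP : (fun p : Fin s × Fin m => P (c p.1) (fun k => A k p.1) p.2) =
        ∑ j ∈ Icc 1 l, (Δt ^ j / (j.factorial : ℝ)) • ∑ k, fun p : Fin s × Fin m =>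
          γ (c p.1) (fun k => A k p.1) j k * iteratedDeriv (j - 1) (φ k) tn p.2 := by
      ext p
      simp [P, Finset.sum_apply]
    rw [hP]
    simp only [hdk, Finset.sum_add_distrib, smul_add, Matrix.mulVec_sum, Matrix.mulVec_smul, P]
  have hone := hstage 1 b
  rw [one_mul] at hone
  rw [hone, hprop, hdsum, add_sub_add_comm, ← Matrix.mulVec_sub]
  have hblocks := norm_mulVec_le_sum_blocks rT
    (fun i => ρ (c i) (fun k => A k i) - P (c i) (fun k => A k i))
    (fun i => (hM i).trans (le_abs_self M))
  calc _ ≤ K 1 b * Δt ^ (l + 1) * Φ +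
        ∑ i, |M| * (K (c i) (fun k => A k i) * Δt ^ (l + 1) * Φ) := by
        refine norm_add_le_of_le (hres 1 b zero_le_one h1b) (hblocks.trans ?_)
        gcongr with i
        exact hres _ _ (hcnn i) (hcb i)
    _ = (K 1 b + ∑ i, |M| * K (c i) (fun k => A k i)) * Δt ^ (l + 1) * Φ := by
        simp only [add_mul, Finset.sum_mul, mul_assoc]
    _ ≤ _ := by
        gcongr ?_ * _ * _
        linarith
end

section
/- Let R ∈ ℝ^{m×m} satisfy sup_{n≥0} ‖R^n‖_∞ ≤ K. Let (ε_n), (ξ_n), (η_n) be sequences in ℝ^m with ε_0 = 0 and ε_{n+1} = R ε_n + δ_n for all n ≥ 0, where δ_n = (R − I) ξ_n + η_n. Then for every n ≥ 0: ‖ε_n‖_∞ ≤ ‖ξ_n‖_∞ + K ‖ξ_0‖_∞ + K Σ_{j=0}^{n-1} ( ‖ξ_{j+1} − ξ_j‖_∞ + ‖η_j‖_∞ ). -/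
open Matrix

attribute [local instance] Matrix.linftyOpNormedAddCommGroup

/-- A linear recursion with power-bounded amplification matrix accumulates at most `K` times the
initial value and the inhomogeneities, even after further applications of the matrix. -/
theorem norm_pow_mulVec_le_of_recursion {ι : Type*} [Fintype ι] [DecidableEq ι]
    {R : Matrix ι ι ℝ} {K : ℝ} (hK : ∀ n : ℕ, ‖R ^ n‖ ≤ K) {e g : ℕ → ι → ℝ}
    (hrec : ∀ n, e (n + 1) = R *ᵥ e n + g n) (n k : ℕ) :
    ‖(R ^ k) *ᵥ e n‖ ≤ K * ‖e 0‖ + K * ∑ j ∈ Finset.range n, ‖g j‖ := by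
  have hbound (k : ℕ) (v : ι → ℝ) : ‖(R ^ k) *ᵥ v‖ ≤ K * ‖v‖ :=
    (linfty_opNorm_mulVec _ _).trans (by gcongr; exact hK k)
  induction n generalizing k with
  | zero => simpa using hbound k (e 0)
  | succ n ih =>
    rw [hrec, mulVec_add, mulVec_mulVec, ← pow_succ, Finset.sum_range_succ]
    linarith [norm_add_le ((R ^ (k + 1)) *ᵥ e n) ((R ^ k) *ᵥ g n), ih (k + 1), hbound k (g n)]

/-- Error-propagation inequality: if `sup_n ‖Rⁿ‖_∞ ≤ K`, `ε₀ = 0` and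
`ε_{n+1} = R εₙ + δₙ` with `δₙ = (R − I) ξₙ + ηₙ`, then
`‖εₙ‖ ≤ ‖ξₙ‖ + K‖ξ₀‖ + K ∑_{j<n} (‖ξ_{j+1} − ξ_j‖ + ‖η_j‖)`. -/
theorem stmt_7
    (m : ℕ) (R : Matrix (Fin m) (Fin m) ℝ) (K : ℝ)
    (hK : ∀ n : ℕ, ‖R ^ n‖ ≤ K)
    (ε ξ η : ℕ → (Fin m → ℝ))
    (hε0 : ε 0 = 0)
    (hrec : ∀ n, ε (n + 1) = R.mulVec (ε n) + ((R - 1).mulVec (ξ n) + η n)) :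
    ∀ n, ‖ε n‖ ≤ ‖ξ n‖ + K * ‖ξ 0‖ +
        K * ∑ j ∈ Finset.range n, (‖ξ (j + 1) - ξ j‖ + ‖η j‖) := by
  intro n
  have hK0 : 0 ≤ K := (norm_nonneg _).trans (hK 0)
  have hshift (n : ℕ) :
      (ε + ξ) (n + 1) = R *ᵥ (ε + ξ) n + ((ξ (n + 1) - ξ n) + η n) := by
    simp only [Pi.add_apply, hrec, mulVec_add, sub_mulVec, one_mulVec]
    abel
  have hsum : ‖ε n + ξ n‖ ≤
      K * ‖ξ 0‖ + K * ∑ j ∈ Finset.range n, ‖(ξ (j + 1) - ξ j) + η j‖ := by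
    simpa [hε0] using norm_pow_mulVec_le_of_recursion hK hshift n 0
  calc ‖ε n‖ = ‖(ε n + ξ n) - ξ n‖ := by rw [add_sub_cancel_right]
    _ ≤ ‖ε n + ξ n‖ + ‖ξ n‖ := norm_sub_le _ _
    _ ≤ (K * ‖ξ 0‖ + K * ∑ j ∈ Finset.range n, ‖(ξ (j + 1) - ξ j) + η j‖) + ‖ξ n‖ := by gcongr
    _ ≤ (K * ‖ξ 0‖ + K * ∑ j ∈ Finset.range n, (‖ξ (j + 1) - ξ j‖ + ‖η j‖)) + ‖ξ n‖ := by
      gcongr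
      exact norm_add_le _ _
    _ = _ := by ring
end

section
/- Let R ∈ ℝ^{m×m} satisfy sup_{n≥0} ‖R^n‖_∞ ≤ K, and let (ε_n), (ξ_n), (η_n) be sequences in ℝ^m with ε_0 = 0 and ε_{n+1} = R ε_n + (R − I) ξ_n + η_n for all n ≥ 0. Let Δt > 0, T > 0, q ≥ 0, and constants C₁, C₂, C₃ ≥ 0 be such that for all n with n Δt ≤ T: ‖ξ_n‖_∞ ≤ C₁ Δt^{q+1}, ‖ξ_{n+1} − ξ_n‖_∞ ≤ C₂ Δt^{q+2}, and ‖η_n‖_∞ ≤ C₃ Δt^{q+2}. Then for all n with n Δt ≤ T: ‖ε_n‖_∞ ≤ ( (1 + K) C₁ + K T (C₂ + C₃) ) Δt^{q+1}. In particular the scheme converges with order q+1 in the maximum norm. -/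
open Matrix

attribute [local instance] Matrix.linftyOpNormedAddCommGroup

/-- Discrete variation of constants for a power-bounded matrix: a recursion
`e (n + 1) = R e n + d n` with `‖d k‖ ≤ D` for `k < n` grows at most linearly. The extra power
`R ^ j` makes the induction go through. -/
lemma norm_pow_mulVec_le_of_rec {ι : Type*} [Fintype ι] [DecidableEq ι] {R : Matrix ι ι ℝ}
    {K D : ℝ} (hK : ∀ n : ℕ, ‖R ^ n‖ ≤ K) {e d : ℕ → ι → ℝ}
    (he : ∀ n, e (n + 1) = R *ᵥ e n + d n) (n j : ℕ) (hd : ∀ k < n, ‖d k‖ ≤ D) :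
    ‖(R ^ j) *ᵥ e n‖ ≤ K * ‖e 0‖ + n * (K * D) := by
  have hK0 : 0 ≤ K := (norm_nonneg _).trans (hK 0)
  have hmul (i : ℕ) (v : ι → ℝ) : ‖(R ^ i) *ᵥ v‖ ≤ K * ‖v‖ :=
    (linfty_opNorm_mulVec _ _).trans (mul_le_mul_of_nonneg_right (hK i) (norm_nonneg v))
  induction n generalizing j with
  | zero => simpa using hmul j (e 0)
  | succ n ih =>
    have h : (R ^ j) *ᵥ e (n + 1) = (R ^ (j + 1)) *ᵥ e n + (R ^ j) *ᵥ d n := by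
      rw [he, mulVec_add, mulVec_mulVec, pow_succ]
    calc ‖(R ^ j) *ᵥ e (n + 1)‖
        ≤ ‖(R ^ (j + 1)) *ᵥ e n‖ + ‖(R ^ j) *ᵥ d n‖ := h ▸ norm_add_le _ _
      _ ≤ (K * ‖e 0‖ + n * (K * D)) + K * D :=
        add_le_add (ih (j + 1) fun k hk => hd k (hk.trans n.lt_succ_self))
          ((hmul j _).trans (mul_le_mul_of_nonneg_left (hd n n.lt_succ_self) hK0))
      _ = K * ‖e 0‖ + (n + 1 : ℕ) * (K * D) := by push_cast; ring

/-- Convergence of order `q+1`: for the stable error recursion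
`ε_{n+1} = R εₙ + (R − I) ξₙ + ηₙ` with `‖ξₙ‖ ≤ C₁ Δt^{q+1}`,
`‖ξ_{n+1} − ξₙ‖ ≤ C₂ Δt^{q+2}` and `‖ηₙ‖ ≤ C₃ Δt^{q+2}` on `n Δt ≤ T`, one has
`‖εₙ‖ ≤ ((1+K)C₁ + K T (C₂+C₃)) Δt^{q+1}` for all `n Δt ≤ T`. -/
theorem stmt_8
    (m : ℕ) (R : Matrix (Fin m) (Fin m) ℝ) (K : ℝ)
    (hK : ∀ n : ℕ, ‖R ^ n‖ ≤ K)
    (ε ξ η : ℕ → (Fin m → ℝ))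
    (hε0 : ε 0 = 0)
    (hrec : ∀ n, ε (n + 1) = R.mulVec (ε n) + ((R - 1).mulVec (ξ n) + η n))
    (Δt T : ℝ) (hΔt : 0 < Δt) (hT : 0 < T) (q : ℕ)
    (C₁ C₂ C₃ : ℝ) (hC₁ : 0 ≤ C₁) (hC₂ : 0 ≤ C₂) (hC₃ : 0 ≤ C₃)
    (hξ : ∀ n : ℕ, (n : ℝ) * Δt ≤ T → ‖ξ n‖ ≤ C₁ * Δt ^ (q + 1))
    (hdξ : ∀ n : ℕ, (n : ℝ) * Δt ≤ T → ‖ξ (n + 1) - ξ n‖ ≤ C₂ * Δt ^ (q + 2))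
    (hη : ∀ n : ℕ, (n : ℝ) * Δt ≤ T → ‖η n‖ ≤ C₃ * Δt ^ (q + 2)) :
    ∀ n : ℕ, (n : ℝ) * Δt ≤ T →
      ‖ε n‖ ≤ ((1 + K) * C₁ + K * T * (C₂ + C₃)) * Δt ^ (q + 1) := by
  intro n hn
  have hK0 : 0 ≤ K := (norm_nonneg _).trans (hK 0)
  have he (k : ℕ) : ε (k + 1) + ξ (k + 1) = R *ᵥ (ε k + ξ k) + ((ξ (k + 1) - ξ k) + η k) := by
    rw [hrec, mulVec_add, sub_mulVec, one_mulVec]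
    abel
  have hd (k : ℕ) (hk : k < n) :
      ‖(ξ (k + 1) - ξ k) + η k‖ ≤ (C₂ + C₃) * Δt ^ (q + 2) := by
    have hkT : (k : ℝ) * Δt ≤ T := le_trans (by gcongr) hn
    rw [add_mul]
    exact (norm_add_le _ _).trans (add_le_add (hdξ k hkT) (hη k hkT))
  have hsum : ‖ε n + ξ n‖ ≤ K * ‖ξ 0‖ + n * (K * ((C₂ + C₃) * Δt ^ (q + 2))) := by
    simpa [hε0] using
      norm_pow_mulVec_le_of_rec (e := fun k => ε k + ξ k) hK he n 0 hd
  have hξ0 : ‖ξ 0‖ ≤ C₁ * Δt ^ (q + 1) := hξ 0 (by simpa using hT.le)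
  calc ‖ε n‖ = ‖(ε n + ξ n) - ξ n‖ := by rw [add_sub_cancel_right]
    _ ≤ ‖ε n + ξ n‖ + ‖ξ n‖ := norm_sub_le _ _
    _ ≤ (K * (C₁ * Δt ^ (q + 1)) + n * (K * ((C₂ + C₃) * Δt ^ (q + 2))))
          + C₁ * Δt ^ (q + 1) := by
      refine add_le_add (hsum.trans ?_) (hξ n hn)
      gcongr
    _ = (1 + K) * C₁ * Δt ^ (q + 1)
          + (n * Δt) * (K * (C₂ + C₃) * Δt ^ (q + 1)) := by ring
    _ ≤ (1 + K) * C₁ * Δt ^ (q + 1) + T * (K * (C₂ + C₃) * Δt ^ (q + 1)) := by gcongr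
    _ = ((1 + K) * C₁ + K * T * (C₂ + C₃)) * Δt ^ (q + 1) := by ring
end

section
/- Consider the OS1 scheme with Z_1, Z_2 ∈ ℝ^{m×m}, Z = Z_1 + Z_2, and let I_1, I_2 be diagonal matrices with diagonal entries in {0,1} such that I_1 + I_2 = I. Let 0 ≤ θ < 1 and assume ‖Z_2‖_∞ ≤ 4θ. Then I + (1/4) Z_2 is invertible with ‖(I + (1/4) Z_2)^{-1}‖_∞ ≤ 1/(1 − θ), and the matrix W := (1/4) (I + (1/4) Z_2)^{-1} I_1 satisfies ( r(Z)^T (e ⊗ I) ) W = d_{1,1}(Z) I_1 + d_{1,2}(Z) I_2 and ‖W‖_∞ ≤ 1/(1 − θ). -/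
open Matrix Kronecker

attribute [local instance] Matrix.linftyOpNormedAddCommGroup

/-- A diagonal matrix with entries bounded by one has `∞`-operator norm at most one. -/
lemma linfty_opNorm_diagonal_le_one {m : ℕ} {v : Fin m → ℝ} (hv : ∀ i, ‖v i‖ ≤ 1) :
    ‖(Matrix.diagonal v : Matrix (Fin m) (Fin m) ℝ)‖ ≤ 1 := by
  rw [Matrix.linfty_opNorm_diagonal]
  exact (pi_norm_le_iff_of_nonneg zero_le_one).2 hv

lemma linfty_opNorm_one_le_one {m : ℕ} : ‖(1 : Matrix (Fin m) (Fin m) ℝ)‖ ≤ 1 := by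
  rw [← Matrix.diagonal_one]
  exact linfty_opNorm_diagonal_le_one fun _ => by simp

lemma isUnit_one_add_of_linfty_opNorm_lt_one {m : ℕ} {A : Matrix (Fin m) (Fin m) ℝ}
    (hA : ‖A‖ < 1) : IsUnit (1 + A) := by
  let _ : NormedRing (Matrix (Fin m) (Fin m) ℝ) := Matrix.linftyOpNormedRing
  let _ : NormedAlgebra ℝ (Matrix (Fin m) (Fin m) ℝ) := Matrix.linftyOpNormedAlgebra
  have : CompleteSpace (Matrix (Fin m) (Fin m) ℝ) := FiniteDimensional.complete ℝ _
  rw [← sub_neg_eq_add]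
  exact isUnit_one_sub_of_norm_lt_one (by rwa [norm_neg])

/-- The Neumann series bound for the inverse of a perturbation of the identity. -/
lemma linfty_opNorm_inv_one_add_le {m : ℕ} {A : Matrix (Fin m) (Fin m) ℝ} {θ : ℝ}
    (hA : ‖A‖ ≤ θ) (hθ : θ < 1) : ‖(1 + A)⁻¹‖ ≤ 1 / (1 - θ) := by
  have hu : IsUnit (1 + A).det :=
    (Matrix.isUnit_iff_isUnit_det _).1 (isUnit_one_add_of_linfty_opNorm_lt_one (hA.trans_lt hθ))
  have heq : (1 + A)⁻¹ = 1 - A * (1 + A)⁻¹ := by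
    rw [eq_sub_iff_add_eq]
    simpa [add_mul] using Matrix.mul_nonsing_inv _ hu
  have h : ‖(1 + A)⁻¹‖ ≤ 1 + θ * ‖(1 + A)⁻¹‖ :=
    calc ‖(1 + A)⁻¹‖ = ‖1 - A * (1 + A)⁻¹‖ := congrArg norm heq
      _ ≤ ‖(1 : Matrix (Fin m) (Fin m) ℝ)‖ + ‖A * (1 + A)⁻¹‖ := norm_sub_le _ _
      _ ≤ 1 + ‖A‖ * ‖(1 + A)⁻¹‖ :=
        add_le_add linfty_opNorm_one_le_one (Matrix.linfty_opNorm_mul _ _)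
      _ ≤ 1 + θ * ‖(1 + A)⁻¹‖ := by gcongr
  rw [le_div_iff₀ (by linarith)]
  linarith

lemma inv_one_sub_of_mul_self_eq_zero {n : Type*} [Fintype n] [DecidableEq n]
    {N : Matrix n n ℝ} (hN : N * N = 0) : (1 - N)⁻¹ = 1 + N :=
  Matrix.inv_eq_right_inv (by rw [sub_mul, one_mul, mul_add, mul_one, hN]; abel)

/-- For the OS1 scheme with cell-based partition `I₁ + I₂ = I` and `‖Z₂‖_∞ ≤ 4θ < 4`:
`I + (1/4) Z₂` is invertible with `‖(I + (1/4) Z₂)⁻¹‖_∞ ≤ 1/(1−θ)`, and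
`W = (1/4)(I + (1/4) Z₂)⁻¹ I₁` satisfies `(r(Z)ᵀ(e⊗I)) W = d_{1,1}(Z) I₁ + d_{1,2}(Z) I₂`
and `‖W‖_∞ ≤ 1/(1−θ)`. -/
theorem stmt_12
    (m : ℕ) (Z1 Z2 : Matrix (Fin m) (Fin m) ℝ)
    (I1 I2 : Matrix (Fin m) (Fin m) ℝ)
    (hI1diag : ∀ i j : Fin m, i ≠ j → I1 i j = 0)
    (hI1ent : ∀ i : Fin m, I1 i i = 0 ∨ I1 i i = 1)
    (hI12 : I1 + I2 = 1)
    (θ : ℝ) (hθ0 : 0 ≤ θ) (hθ1 : θ < 1)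
    (hZ2 : ‖Z2‖ ≤ 4 * θ)
    (N : Matrix (Fin 2 × Fin m) (Fin 2 × Fin m) ℝ)
    (hN : N = (0 : Matrix (Fin 2) (Fin 2) ℝ) ⊗ₖ Z1 + (!![0, 0; 1/2, 0]) ⊗ₖ Z2)
    (B : Matrix (Fin m) (Fin 2 × Fin m) ℝ)
    (hB : B = Matrix.of fun i p =>
        (![(1/2 : ℝ), 1/2]) p.1 * Z1 i p.2 + (![(1/2 : ℝ), 1/2]) p.1 * Z2 i p.2)
    (rT : Matrix (Fin m) (Fin 2 × Fin m) ℝ)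
    (hrT : rT = B * (1 - N)⁻¹)
    (E : Matrix (Fin 2 × Fin m) (Fin m) ℝ)
    (hE : E = Matrix.of fun p i => if p.2 = i then (1 : ℝ) else 0)
    (d11 d12 : Matrix (Fin m) (Fin m) ℝ)
    (hd11 : d11 = (1 - ∑ i, (![(1/2 : ℝ), 1/2]) i) • (1 : Matrix (Fin m) (Fin m) ℝ)
        + rT * Matrix.of (fun p i =>
            ((![(0 : ℝ), 1/2]) p.1 - ∑ j, (0 : Matrix (Fin 2) (Fin 2) ℝ) p.1 j) *
              (if p.2 = i then (1 : ℝ) else 0)))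
    (hd12 : d12 = (1 - ∑ i, (![(1/2 : ℝ), 1/2]) i) • (1 : Matrix (Fin m) (Fin m) ℝ)
        + rT * Matrix.of (fun p i =>
            ((![(0 : ℝ), 1/2]) p.1 - ∑ j, (!![0, 0; 1/2, 0] : Matrix (Fin 2) (Fin 2) ℝ) p.1 j) *
              (if p.2 = i then (1 : ℝ) else 0)))
    (W : Matrix (Fin m) (Fin m) ℝ)
    (hW : W = (1/4 : ℝ) • ((1 + (1/4 : ℝ) • Z2)⁻¹ * I1)) :
    IsUnit (1 + (1/4 : ℝ) • Z2) ∧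
    ‖(1 + (1/4 : ℝ) • Z2)⁻¹‖ ≤ 1 / (1 - θ) ∧
    (rT * E) * W = d11 * I1 + d12 * I2 ∧
    ‖W‖ ≤ 1 / (1 - θ) := by
  have hA : ‖(1/4 : ℝ) • Z2‖ ≤ θ := by
    let _ : NormedSpace ℝ (Matrix (Fin m) (Fin m) ℝ) := Matrix.linftyOpNormedSpace
    rw [norm_smul, Real.norm_of_nonneg (by norm_num)]
    linarith
  have hunit := isUnit_one_add_of_linfty_opNorm_lt_one (hA.trans_lt hθ1)
  have hinv := linfty_opNorm_inv_one_add_le hA hθ1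
  have hI1 : ‖I1‖ ≤ 1 := by
    have hdiag : I1 = Matrix.diagonal fun i => I1 i i := by
      ext i j
      rcases eq_or_ne i j with rfl | hij
      · simp
      · simp [hij, hI1diag i j hij]
    rw [hdiag]
    exact linfty_opNorm_diagonal_le_one fun i => by rcases hI1ent i with h | h <;> simp [h]
  have hNN : N * N = 0 := by
    ext ⟨a, i⟩ ⟨b, j⟩
    fin_cases a <;> fin_cases b <;>
      simp [hN, Matrix.mul_apply, Fintype.sum_prod_type, Matrix.kroneckerMap_apply]
  rw [inv_one_sub_of_mul_self_eq_zero hNN] at hrT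
  have hNE : N * E = Matrix.of fun p i => (![(0 : ℝ), 1/2]) p.1 * Z2 p.2 i := by
    ext ⟨a, i⟩ j
    fin_cases a <;>
      simp [hN, hE, Matrix.mul_apply, Fintype.sum_prod_type, Matrix.kroneckerMap_apply]
  have hBE : B * E = Z1 + Z2 := by
    ext i j
    simp [hB, hE, Matrix.mul_apply, Fintype.sum_prod_type]
    ring
  have hBNE : B * (N * E) = (Z1 + Z2) * ((1/4 : ℝ) • Z2) := by
    ext i j
    simp only [hNE, hB, Matrix.mul_apply, Fintype.sum_prod_type, Fin.sum_univ_two]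
    simp
    exact Finset.sum_congr rfl fun k _ => by ring
  have hrE : rT * E = (Z1 + Z2) * (1 + (1/4 : ℝ) • Z2) := by
    rw [hrT, Matrix.mul_assoc, Matrix.add_mul, Matrix.one_mul, Matrix.mul_add, hBE, hBNE,
      mul_add, mul_one]
  have hb : 1 - ∑ i, (![(1/2 : ℝ), 1/2]) i = 0 := by
    norm_num [Fin.sum_univ_two]
  let C : Matrix (Fin 2 × Fin m) (Fin m) ℝ :=
    Matrix.of fun p i => (![(0 : ℝ), 1/2]) p.1 * (if p.2 = i then (1 : ℝ) else 0)
  have hd11' : d11 = (1/4 : ℝ) • (Z1 + Z2) := by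
    have hC : (Matrix.of fun (p : Fin 2 × Fin m) (i : Fin m) =>
        ((![(0 : ℝ), 1/2]) p.1 - ∑ j, (0 : Matrix (Fin 2) (Fin 2) ℝ) p.1 j) *
          (if p.2 = i then (1 : ℝ) else 0)) = C := by
      ext ⟨a, i⟩ j
      fin_cases a <;> simp [C]
    have hNC : N * C = 0 := by
      ext ⟨a, i⟩ j
      fin_cases a <;>
        simp [C, hN, Matrix.mul_apply, Fintype.sum_prod_type, Matrix.kroneckerMap_apply]
    have hBC : B * C = (1/4 : ℝ) • (Z1 + Z2) := by
      ext i j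
      simp [C, hB, Matrix.mul_apply, Fintype.sum_prod_type]
      ring
    have hrC : rT * C = (1/4 : ℝ) • (Z1 + Z2) := by
      rw [hrT, Matrix.mul_assoc, Matrix.add_mul, Matrix.one_mul, hNC, add_zero, hBC]
    rw [hC] at hd11
    rw [hd11, hb, zero_smul, zero_add]
    exact hrC
  have hd12' : d12 = 0 := by
    have hC : (Matrix.of fun (p : Fin 2 × Fin m) (i : Fin m) =>
        ((![(0 : ℝ), 1/2]) p.1 - ∑ j, (!![0, 0; 1/2, 0] : Matrix (Fin 2) (Fin 2) ℝ) p.1 j) *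
          (if p.2 = i then (1 : ℝ) else 0)) = 0 := by
      ext ⟨a, i⟩ j
      fin_cases a <;> simp
    rw [hC] at hd12
    rw [hd12, hb, zero_smul, zero_add]
    exact Matrix.mul_zero rT
  refine ⟨hunit, hinv, ?_, ?_⟩
  · rw [hrE, hd11', hd12', hW, zero_mul, add_zero, mul_smul_comm, smul_mul_assoc, mul_assoc,
      Matrix.mul_nonsing_inv_cancel_left _ _ ((Matrix.isUnit_iff_isUnit_det _).1 hunit)]
  · let _ : NormedSpace ℝ (Matrix (Fin m) (Fin m) ℝ) := Matrix.linftyOpNormedSpace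
    have hmul : ‖(1 + (1/4 : ℝ) • Z2)⁻¹ * I1‖ ≤ ‖(1 + (1/4 : ℝ) • Z2)⁻¹‖ :=
      (Matrix.linfty_opNorm_mul _ _).trans (mul_le_of_le_one_right (norm_nonneg _) hI1)
    rw [hW, norm_smul, Real.norm_of_nonneg (by norm_num)]
    linarith [norm_nonneg ((1 + (1/4 : ℝ) • Z2)⁻¹ * I1)]
end

section
/- Let m ≥ 2, let Δx_1,…,Δx_m > 0, and let L ∈ ℝ^{m×m} be the first-order upwind matrix: L_{jj} = −1/Δx_j for all j, L_{j,j-1} = 1/Δx_j for j ≥ 2, and all other entries zero. For 2 ≤ i ≤ m let J be the diagonal matrix with J_{jj} = 1 for j ≤ i−1 and J_{jj} = 0 for j ≥ i. Then for every τ > 0: ‖I + τ L J‖_∞ ≥ 1 + τ/Δx_i > 1. In particular the flux-based split operator F_1(v) = L J v does not satisfy the monotonicity bound ‖v + τ F_1(v)‖_∞ ≤ ‖v‖_∞ for any τ > 0. -/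
open Matrix

attribute [local instance] Matrix.linftyOpNormedAddCommGroup

/-- For the first-order upwind matrix `L` and the flux-based projection `J` onto the
fluxes of cells `1,…,i−1`, one has `‖I + τ L J‖_∞ ≥ 1 + τ/Δxᵢ > 1` for every `τ > 0`;
in particular `F₁(v) = L J v` violates the monotonicity bound `‖v + τ F₁(v)‖_∞ ≤ ‖v‖_∞`. -/
theorem stmt_13
    (m : ℕ) (hm : 2 ≤ m)
    (Δx : Fin m → ℝ) (hΔx : ∀ j, 0 < Δx j)
    (L : Matrix (Fin m) (Fin m) ℝ)
    (hLd : ∀ j : Fin m, L j j = -(1 / Δx j))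
    (hLs : ∀ j k : Fin m, (k : ℕ) + 1 = (j : ℕ) → L j k = 1 / Δx j)
    (hL0 : ∀ j k : Fin m, j ≠ k → (k : ℕ) + 1 ≠ (j : ℕ) → L j k = 0)
    (i : Fin m) (hi : 1 ≤ (i : ℕ))
    (J : Matrix (Fin m) (Fin m) ℝ)
    (hJ : ∀ j k : Fin m, J j k = if j = k ∧ (j : ℕ) < (i : ℕ) then 1 else 0)
    (τ : ℝ) (hτ : 0 < τ) :
    1 + τ / Δx i ≤ ‖(1 : Matrix (Fin m) (Fin m) ℝ) + τ • (L * J)‖ ∧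
    1 < 1 + τ / Δx i ∧
    ¬ (∀ v : Fin m → ℝ, ‖v + τ • (L * J).mulVec v‖ ≤ ‖v‖) := by
  have hJv : J *ᵥ (1 : Fin m → ℝ) =
        fun k : Fin m => if (k : ℕ) < (i : ℕ) then 1 else 0 := by
    ext k
    simp [mulVec, dotProduct, hJ, ite_and]
  have hrow : ((L * J) *ᵥ (1 : Fin m → ℝ)) i = 1 / Δx i := by
    rw [← mulVec_mulVec, hJv]
    have hlt : (i : ℕ) - 1 < m := by omega
    simp only [mulVec, dotProduct]
    rw [Finset.sum_eq_single (⟨(i : ℕ) - 1, hlt⟩ : Fin m)]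
    · rw [hLs _ _ (by simp only; omega), if_pos (by simp only; omega), mul_one]
    · intro k _ hk
      by_cases hki : (k : ℕ) < (i : ℕ)
      · rw [hL0 i k (by rintro rfl; omega) (fun h => hk (Fin.ext (by simp only; omega))),
          zero_mul]
      · rw [if_neg hki, mul_zero]
    · simp
  have hone : ‖(1 : Fin m → ℝ)‖ = 1 := by
    have : Nonempty (Fin m) := ⟨i⟩
    exact norm_one
  have hgt : 1 < 1 + τ / Δx i := lt_add_of_pos_right 1 (div_pos hτ (hΔx i))
  have hlow : 1 + τ / Δx i ≤ ‖(1 : Fin m → ℝ) + τ • ((L * J) *ᵥ (1 : Fin m → ℝ))‖ := by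
    refine le_trans (le_of_eq ?_) ((le_abs_self _).trans
      (norm_le_pi_norm ((1 : Fin m → ℝ) + τ • ((L * J) *ᵥ (1 : Fin m → ℝ))) i))
    simp only [Pi.add_apply, Pi.smul_apply, Pi.one_apply, smul_eq_mul, hrow]
    ring
  refine ⟨?_, hgt, fun h => ?_⟩
  · have hop := linfty_opNorm_mulVec
      ((1 : Matrix (Fin m) (Fin m) ℝ) + τ • (L * J)) (1 : Fin m → ℝ)
    rw [add_mulVec, one_mulVec, smul_mulVec, hone, mul_one] at hop
    exact hlow.trans hop
  · exact (hgt.trans_le hlow).not_ge ((h 1).trans_eq hone)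
end

section
/- Let m ≥ 2 and 2 ≤ i ≤ m, let Δx_1,…,Δx_m > 0, let L ∈ ℝ^{m×m} be the first-order upwind matrix (L_{jj} = −1/Δx_j, L_{j,j-1} = 1/Δx_j for j ≥ 2, zero elsewhere), and let the flux-based splitting at interface i be F_1(v) = L J_1 v and F_2(v) = L J_2 v, where J_1 is the diagonal 0/1 matrix selecting indices {1,…,i−1} and J_2 = I − J_1. Apply one step of the OS1 scheme from u ∈ ℝ^m: stage w = u + (1/2) Δt F_2(u), update u₊ = u + (1/2) Δt (F_1(u) + F_2(u)) + (1/2) Δt (F_1(w) + F_2(w)). Then the i-th component satisfies u₊_i = u_i + (Δt/Δx_i)(u_{i-1} − u_i) + (1/4)(Δt/Δx_i)² u_i. In particular, starting from exact point values of a solution of u_t + u_x = 0 and letting Δt → 0 with ν = Δt/Δx_i held fixed, the error after one step at the interface is (1/4) ν² u(x_i, t_0) + O(Δt), which does not tend to zero. -/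
open Matrix

/-- A bidiagonal upwind row acts as a backward difference quotient. -/
theorem upwind_mulVec_apply {m : ℕ} (Δx : Fin m → ℝ) (L : Matrix (Fin m) (Fin m) ℝ)
    (hLd : ∀ j : Fin m, L j j = -(1 / Δx j))
    (hLs : ∀ j k : Fin m, (k : ℕ) + 1 = (j : ℕ) → L j k = 1 / Δx j)
    (hL0 : ∀ j k : Fin m, j ≠ k → (k : ℕ) + 1 ≠ (j : ℕ) → L j k = 0)
    {i p : Fin m} (hp : (p : ℕ) + 1 = (i : ℕ)) (v : Fin m → ℝ) :
    L.mulVec v i = (v p - v i) / Δx i := by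
  have hpi : p ≠ i := by
    rintro rfl
    omega
  rw [mulVec, dotProduct, Fintype.sum_eq_add p i hpi, hLd, hLs i p hp]
  · ring
  · rintro k ⟨hkp, hki⟩
    rw [hL0 i k (Ne.symm hki) fun h => hkp (Fin.ext (by omega)), zero_mul]

/-- The complement of the diagonal 0/1 selector of the indices below `i` truncates a vector. -/
theorem one_sub_selector_mulVec_apply {m : ℕ} {i : Fin m} {J : Matrix (Fin m) (Fin m) ℝ}
    (hJ : ∀ j k : Fin m, J j k = if j = k ∧ (j : ℕ) < (i : ℕ) then 1 else 0)
    (v : Fin m → ℝ) (k : Fin m) :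
    (1 - J).mulVec v k = if (k : ℕ) < (i : ℕ) then 0 else v k := by
  have hJk : J.mulVec v k = if (k : ℕ) < (i : ℕ) then v k else 0 := by
    simp [mulVec, dotProduct, hJ, ite_and]
  rw [sub_mulVec, one_mulVec, Pi.sub_apply, hJk]
  split_ifs <;> simp

/-- The one-sided estimate `U (x - h) = U x + O(h)` for a differentiable function. -/
theorem exists_abs_sub_le_of_differentiableAt {U : ℝ → ℝ} {x : ℝ} (hU : DifferentiableAt ℝ U x) :
    ∃ K > 0, ∃ ε > 0, ∀ h : ℝ, 0 < h → h < ε → |U (x - h) - U x| ≤ K * h := by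
  obtain ⟨K, hK, hb⟩ := hU.isBigO_sub.exists_pos
  obtain ⟨ε, hε, hball⟩ := Metric.eventually_nhds_iff.1 hb.bound
  refine ⟨K, hK, ε, hε, fun h h0 hlt => ?_⟩
  have key := hball (y := x - h) (by simpa [Real.dist_eq, abs_of_pos h0] using hlt)
  simpa [Real.norm_eq_abs, abs_of_pos h0] using key

/-- One step of the OS1 scheme for the flux-based splitting `F₁ = L J₁`, `F₂ = L J₂` of
the first-order upwind discretization: at the interface component `i`,
`u₊ᵢ = uᵢ + (Δt/Δxᵢ)(u_{i−1} − uᵢ) + (1/4)(Δt/Δxᵢ)² uᵢ`.  In particular, starting from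
exact samples `U(x)`, `U(x − Δt/ν)` of a solution of `u_t + u_x = 0` and letting `Δt → 0`
with `ν = Δt/Δxᵢ` fixed, the one-step interface error is `(1/4) ν² U(x) + O(Δt)`. -/
theorem stmt_14
    (m : ℕ) (hm : 2 ≤ m)
    (Δx : Fin m → ℝ) (hΔx : ∀ j, 0 < Δx j)
    (L : Matrix (Fin m) (Fin m) ℝ)
    (hLd : ∀ j : Fin m, L j j = -(1 / Δx j))
    (hLs : ∀ j k : Fin m, (k : ℕ) + 1 = (j : ℕ) → L j k = 1 / Δx j)
    (hL0 : ∀ j k : Fin m, j ≠ k → (k : ℕ) + 1 ≠ (j : ℕ) → L j k = 0)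
    (i : Fin m) (hi : 1 ≤ (i : ℕ))
    (J1 J2 : Matrix (Fin m) (Fin m) ℝ)
    (hJ1 : ∀ j k : Fin m, J1 j k = if j = k ∧ (j : ℕ) < (i : ℕ) then 1 else 0)
    (hJ2 : J2 = 1 - J1)
    (Δt : ℝ) (hΔt : 0 < Δt)
    (u w uplus : Fin m → ℝ)
    (hw : w = u + (Δt / 2) • (L * J2).mulVec u)
    (hu : uplus = u + (Δt / 2) • ((L * J1).mulVec u + (L * J2).mulVec u)
        + (Δt / 2) • ((L * J1).mulVec w + (L * J2).mulVec w)) :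
    (uplus i = u i
        + (Δt / Δx i) * (u ⟨(i : ℕ) - 1, lt_of_le_of_lt (Nat.sub_le _ _) i.isLt⟩ - u i)
        + (1 / 4) * (Δt / Δx i) ^ 2 * u i) ∧
    (∀ (U : ℝ → ℝ), ContDiff ℝ 1 U → ∀ (x ν : ℝ), 0 < ν →
      ∃ C > 0, ∃ δ > 0, ∀ dt : ℝ, 0 < dt → dt < δ →
        |((U x + ν * (U (x - dt / ν) - U x) + (1 / 4) * ν ^ 2 * U x) - U (x - dt))
            - (1 / 4) * ν ^ 2 * U x| ≤ C * dt) := by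
  constructor
  · set p : Fin m := ⟨(i : ℕ) - 1, lt_of_le_of_lt (Nat.sub_le _ _) i.isLt⟩ with hp_def
    have hp : (p : ℕ) + 1 = (i : ℕ) := Nat.sub_add_cancel hi
    have hL := upwind_mulVec_apply Δx L hLd hLs hL0 hp
    have hsplit (v : Fin m → ℝ) : (L * J1).mulVec v + (L * J2).mulVec v = L.mulVec v := by
      rw [← add_mulVec, ← Matrix.mul_add, hJ2, add_sub_cancel, Matrix.mul_one]
    have hJ2v := one_sub_selector_mulVec_apply hJ1 u
    rw [← hJ2] at hJ2v
    have hwi : w i = u i - Δt / 2 * (u i / Δx i) := by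
      have hpi : (p : ℕ) < (i : ℕ) := by omega
      rw [hw, Pi.add_apply, Pi.smul_apply, ← mulVec_mulVec, hL, hJ2v, hJ2v, if_pos hpi,
        if_neg (lt_irrefl _), smul_eq_mul]
      ring
    have hwp : w p = u p := by
      have hzero : L.mulVec (J2.mulVec u) p = 0 := by
        rw [mulVec, dotProduct]
        refine Finset.sum_eq_zero fun k _ => ?_
        rw [hJ2v]
        split_ifs with hk
        · exact mul_zero _
        · have hpk : p ≠ k := by
            rintro rfl
            omega
          rw [hL0 p k hpk (by omega), zero_mul]
      rw [hw, Pi.add_apply, Pi.smul_apply, ← mulVec_mulVec, hzero, smul_zero, add_zero]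
    rw [hu, hsplit, hsplit]
    simp only [Pi.add_apply, Pi.smul_apply, smul_eq_mul, hL, hwi, hwp]
    ring
  · intro U hU x ν hν
    obtain ⟨K, hK, ε, hε, hb⟩ := exists_abs_sub_le_of_differentiableAt
      (hU.differentiable one_ne_zero x)
    refine ⟨2 * K, by positivity, min ε (ε * ν), by positivity, fun dt h0 hlt => ?_⟩
    have h1 := hb dt h0 (hlt.trans_le (min_le_left _ _))
    have h2 := hb (dt / ν) (by positivity)
      ((div_lt_iff₀ hν).2 (hlt.trans_le (min_le_right _ _)))
    calc _ = |ν * (U (x - dt / ν) - U x) - (U (x - dt) - U x)| := by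
          congr 1
          ring
      _ ≤ |ν * (U (x - dt / ν) - U x)| + |U (x - dt) - U x| := abs_sub _ _
      _ = ν * |U (x - dt / ν) - U x| + |U (x - dt) - U x| := by
          rw [abs_mul, abs_of_pos hν]
      _ ≤ ν * (K * (dt / ν)) + K * dt := by gcongr
      _ = 2 * K * dt := by
          field_simp
          ring
end

section
/- Let A ∈ ℝ^{s×s} be strictly lower triangular, b_1,…,b_r ∈ ℝ^s, w ∈ ℝ^s, and let p ≥ 2 be such that b_k^T A^j w = 0 for all k and all 0 ≤ j ≤ p−3. Let L ∈ ℝ^{m×m}, Δt > 0, Z = Δt L, and let Z_1,…,Z_r ∈ ℝ^{m×m} with Z_1 + ⋯ + Z_r = Z and ‖Z_k‖_∞ ≤ M for each k. Define Q(Z) = Σ_{k=1}^{r} Σ_{j=0}^{s-1} (b_k^T A^j w) Z_k Z^j. Then there is a constant C depending only on s, r, p, M and the numbers |b_k^T A^j w| such that for every v ∈ ℝ^m: ‖Q(Z) v‖_∞ ≤ C Δt^{p-2} ‖L^{p-2} v‖_∞. -/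
open Matrix

attribute [local instance] Matrix.linftyOpNormedAddCommGroup

theorem norm_pow_mulVec_le {m : ℕ} (B : Matrix (Fin m) (Fin m) ℝ) {K : ℝ} (hB : ‖B‖ ≤ K)
    (n : ℕ) (x : Fin m → ℝ) : ‖(B ^ n).mulVec x‖ ≤ K ^ n * ‖x‖ := by
  have hK : 0 ≤ K := (norm_nonneg B).trans hB
  induction n with
  | zero => simp
  | succ n ih =>
    rw [pow_succ', ← Matrix.mulVec_mulVec]
    calc ‖B.mulVec ((B ^ n).mulVec x)‖ ≤ ‖B‖ * ‖(B ^ n).mulVec x‖ :=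
          Matrix.linfty_opNorm_mulVec _ _
      _ ≤ K * (K ^ n * ‖x‖) := by gcongr
      _ = K ^ (n + 1) * ‖x‖ := by ring

theorem norm_mul_pow_mulVec_le {m : ℕ} (B D : Matrix (Fin m) (Fin m) ℝ) {K N : ℝ}
    (hB : ‖B‖ ≤ K) (hD : ‖D‖ ≤ N) {n j : ℕ} (h : n ≤ j) (x : Fin m → ℝ) :
    ‖(D * B ^ j).mulVec x‖ ≤ N * K ^ (j - n) * ‖(B ^ n).mulVec x‖ := by
  have hN : 0 ≤ N := (norm_nonneg D).trans hD
  rw [← Nat.sub_add_cancel h, pow_add, ← Matrix.mulVec_mulVec, ← Matrix.mulVec_mulVec,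
    Nat.add_sub_cancel]
  calc _ ≤ ‖D‖ * ‖(B ^ (j - n)).mulVec ((B ^ n).mulVec x)‖ := Matrix.linfty_opNorm_mulVec _ _
    _ ≤ N * (K ^ (j - n) * ‖(B ^ n).mulVec x‖) := by
        gcongr
        exact norm_pow_mulVec_le B hB _ _
    _ = _ := by ring

/-- Flux-based splitting bound: if `bₖᵀ Aʲ w = 0` for `0 ≤ j ≤ p−3` and `‖Zₖ‖_∞ ≤ M`
with `Z₁ + ⋯ + Z_r = Z = Δt L`, then
`‖Q(Z) v‖_∞ ≤ C Δt^{p−2} ‖L^{p−2} v‖_∞` where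
`Q(Z) = ∑ₖ ∑_{j<s} (bₖᵀ Aʲ w) Zₖ Zʲ`, with `C` depending only on `s, r, p, M` and the
numbers `|bₖᵀ Aʲ w|`. -/
theorem stmt_16
    (s r p : ℕ) (hp : 2 ≤ p)
    (A : Matrix (Fin s) (Fin s) ℝ)
    (hA : ∀ i j : Fin s, i ≤ j → A i j = 0)
    (b : Fin r → Fin s → ℝ)
    (w : Fin s → ℝ)
    (hord : ∀ (k : Fin r) (j : ℕ), j + 3 ≤ p → ∑ i, b k i * ((A ^ j).mulVec w) i = 0)
    (M : ℝ) :
    ∃ C > 0,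
      ∀ (m : ℕ) (L : Matrix (Fin m) (Fin m) ℝ) (Δt : ℝ), 0 < Δt →
        ∀ (Z : Fin r → Matrix (Fin m) (Fin m) ℝ),
          (∑ k, Z k) = Δt • L →
          (∀ k, ‖Z k‖ ≤ M) →
          ∀ v : Fin m → ℝ,
            ‖(∑ k, ∑ j ∈ Finset.range s,
                (∑ i, b k i * ((A ^ j).mulVec w) i) • (Z k * (Δt • L) ^ j)).mulVec v‖
              ≤ C * Δt ^ (p - 2) * ‖(L ^ (p - 2)).mulVec v‖ := by
  set q : Fin r → ℕ → ℝ := fun k j => ∑ i, b k i * ((A ^ j).mulVec w) i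
  refine ⟨1 + ∑ k, ∑ j ∈ Finset.range s, |q k j| * (|M| * (r * |M|) ^ (j - (p - 2))),
    by positivity, ?_⟩
  intro m L Δt hΔt Z hZ hM v
  have hZM : ∀ k, ‖Z k‖ ≤ |M| := fun k => (hM k).trans (le_abs_self M)
  have hL : ‖Δt • L‖ ≤ r * |M| := by
    rw [← hZ]
    simpa using norm_sum_le_of_le Finset.univ fun k _ => hZM k
  have hpow : ‖((Δt • L) ^ (p - 2)).mulVec v‖ = Δt ^ (p - 2) * ‖(L ^ (p - 2)).mulVec v‖ := by
    rw [smul_pow, Matrix.smul_mulVec, norm_smul, Real.norm_of_nonneg (by positivity)]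
  have hterm : ∀ k, ∀ j ∈ Finset.range s, ‖(q k j • (Z k * (Δt • L) ^ j)).mulVec v‖ ≤
      |q k j| * (|M| * (r * |M|) ^ (j - (p - 2))) * ‖((Δt • L) ^ (p - 2)).mulVec v‖ := by
    intro k j _
    by_cases hj : j + 3 ≤ p
    · have h0 : q k j = 0 := hord k j hj
      simp [h0]
    · rw [Matrix.smul_mulVec, norm_smul, Real.norm_eq_abs, mul_assoc |q k j|]
      gcongr
      exact norm_mul_pow_mulVec_le _ _ hL (hZM k) (by omega) v
  rw [mul_assoc, ← hpow]
  calc _ ≤ ∑ k, ∑ j ∈ Finset.range s, |q k j| * (|M| * (r * |M|) ^ (j - (p - 2))) *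
          ‖((Δt • L) ^ (p - 2)).mulVec v‖ := by
        simp only [Matrix.sum_mulVec]
        exact norm_sum_le_of_le _ fun k _ => norm_sum_le_of_le _ (hterm k)
    _ ≤ _ := by
        simp only [← Finset.sum_mul]
        gcongr
        linarith
end
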